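/- arXiv:1308.4628 — 2 statements merged into one kernel-verified Lean document; each statement's English description precedes it below -/
import Mathlib

section
/- Let p be a prime, q a power of p, and n ≥ 2. Let K be a field which, in case its characteristic is different from p, contains a primitive p-th root of unity. Let A(n) ≤ GL_n(F_q) be the subgroup of all block matrices [[X, u],[0, 1]] with X ∈ GL_{n-1}(F_q) and u ∈ F_q^{n-1}. Then every nonzero module M over K for A(n) (whether finite or infinite dimensional over K) has a one-dimensional K-subspace that is invariant under the subgroup U(n) of upper unitriangular matrices. -/
open Matrix

/-- In a finite group, a set containing `1` and closed under multiplication is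
closed under inverses. -/
lemma inv_mem_of_one_mem_of_mul_mem {G : Type*} [Group G] [Finite G] {S : Set G}
    (h1 : (1 : G) ∈ S) (hmul : ∀ {a b : G}, a ∈ S → b ∈ S → a * b ∈ S) {a : G}
    (ha : a ∈ S) : a⁻¹ ∈ S := by
  have hpow : ∀ m : ℕ, a ^ m ∈ S := by
    intro m
    induction m with
    | zero => simpa using h1
    | succ k ih => rw [pow_succ]; exact hmul ih ha
  have hcard : a ^ Nat.card G = 1 := pow_card_eq_one'
  have hpos : 0 < Nat.card G := Nat.card_pos
  have hinv : a⁻¹ = a ^ (Nat.card G - 1) := by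
    symm
    apply eq_inv_of_mul_eq_one_right
    rw [← pow_succ', Nat.sub_add_cancel hpos]
    exact hcard
  rw [hinv]
  exact hpow _

section GLBasics

variable (F : Type) [Field F] [Fintype F] [DecidableEq F] (n : ℕ)

/-- The subgroup `B` of invertible upper triangular matrices (the standard Borel). -/
def BT : Subgroup (GL (Fin n) F) where
  carrier := {A | (A : Matrix (Fin n) (Fin n) F).BlockTriangular id}
  one_mem' := Matrix.blockTriangular_one
  mul_mem' := by
    intro a b ha hb
    simpa [Units.val_mul] using Matrix.BlockTriangular.mul ha hb
  inv_mem' := by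
    intro a ha
    exact inv_mem_of_one_mem_of_mul_mem
      (S := {A : GL (Fin n) F | (A : Matrix (Fin n) (Fin n) F).BlockTriangular id})
      Matrix.blockTriangular_one
      (fun hx hy => by simpa [Units.val_mul] using Matrix.BlockTriangular.mul hx hy) ha

/-- The subgroup `U` of upper unitriangular matrices. -/
def UT : Subgroup (GL (Fin n) F) where
  carrier := {A | (A : Matrix (Fin n) (Fin n) F).BlockTriangular id ∧
      ∀ i, (A : Matrix (Fin n) (Fin n) F) i i = 1}
  one_mem' := ⟨Matrix.blockTriangular_one, fun i => Matrix.one_apply_eq i⟩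
  mul_mem' := by
    rintro a b ⟨ha1, ha2⟩ ⟨hb1, hb2⟩
    refine ⟨by simpa [Units.val_mul] using ha1.mul hb1, ?_⟩
    intro i
    rw [Units.val_mul, Matrix.mul_apply]
    rw [Finset.sum_eq_single i]
    · rw [ha2 i, hb2 i, one_mul]
    · intro k _ hk
      rcases lt_or_gt_of_ne hk with h | h
      · rw [ha1 (show (id k : Fin n) < id i from h), zero_mul]
      · rw [hb1 (show (id i : Fin n) < id k from h), mul_zero]
    · intro h
      exact absurd (Finset.mem_univ i) h
  inv_mem' := by
    intro a ha
    refine inv_mem_of_one_mem_of_mul_mem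
      (S := {A : GL (Fin n) F | (A : Matrix (Fin n) (Fin n) F).BlockTriangular id ∧
        ∀ i, (A : Matrix (Fin n) (Fin n) F) i i = 1})
      ⟨Matrix.blockTriangular_one, fun i => Matrix.one_apply_eq i⟩ ?_ ha
    rintro x y ⟨hx1, hx2⟩ ⟨hy1, hy2⟩
    refine ⟨by simpa [Units.val_mul] using hx1.mul hy1, ?_⟩
    intro i
    rw [Units.val_mul, Matrix.mul_apply]
    rw [Finset.sum_eq_single i]
    · rw [hx2 i, hy2 i, one_mul]
    · intro k _ hk
      rcases lt_or_gt_of_ne hk with h | h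
      · rw [hx1 (show (id k : Fin n) < id i from h), zero_mul]
      · rw [hy1 (show (id i : Fin n) < id k from h), mul_zero]
    · intro h
      exact absurd (Finset.mem_univ i) h

end GLBasics

section An

variable (F : Type) [Field F] [Fintype F] [DecidableEq F] (n : ℕ)

/-- The subgroup `A(n)` of `GL_n(F_q)` of block matrices `[[X, u], [0, 1]]`, i.e. the
invertible matrices whose last row is that of the identity matrix. -/
def AnSub : Subgroup (GL (Fin n) F) where
  carrier := {A | ∀ i j : Fin n, i.val = n - 1 →
      (A : Matrix (Fin n) (Fin n) F) i j = (1 : Matrix (Fin n) (Fin n) F) i j}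
  one_mem' := fun _ _ _ => rfl
  mul_mem' := by
    intro a b ha hb i j hi
    rw [Units.val_mul, Matrix.mul_apply, Finset.sum_eq_single i]
    · rw [ha i i hi, Matrix.one_apply_eq, one_mul, hb i j hi]
    · intro k _ hk
      rw [ha i k hi, Matrix.one_apply_ne (Ne.symm hk), zero_mul]
    · exact fun h => absurd (Finset.mem_univ _) h
  inv_mem' := by
    intro a ha
    refine inv_mem_of_one_mem_of_mul_mem
      (S := {A : GL (Fin n) F | ∀ i j : Fin n, i.val = n - 1 →
        (A : Matrix (Fin n) (Fin n) F) i j = (1 : Matrix (Fin n) (Fin n) F) i j})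
      (fun _ _ _ => rfl) ?_ ha
    intro x y hx hy i j hi
    rw [Units.val_mul, Matrix.mul_apply, Finset.sum_eq_single i]
    · rw [hx i i hi, Matrix.one_apply_eq, one_mul, hy i j hi]
    · intro k _ hk
      rw [hx i k hi, Matrix.one_apply_ne (Ne.symm hk), zero_mul]
    · exact fun h => absurd (Finset.mem_univ _) h

lemma UT_le_AnSub : UT F n ≤ AnSub F n := by
  rintro A ⟨h1, h2⟩ i j hi
  rcases eq_or_ne j i with rfl | hj
  · rw [h2 j, Matrix.one_apply_eq]
  · have hji : (j : Fin n) < i := by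
      rcases lt_or_gt_of_ne hj with h | h
      · exact h
      · exfalso
        have : (i : Fin n).val < j.val := h
        have : j.val < n := j.isLt
        omega
    rw [h1 (show (id j : Fin n) < id i from hji), Matrix.one_apply_ne (Ne.symm hj)]

end An

/-- An eigenvector of `T` inside a stable submodule, when a product of linear factors of `T`
annihilates some nonzero vector of the submodule. -/
lemma exists_eigenvector_of_multiset_prod {K M : Type*} [Field K] [AddCommGroup M] [Module K M]
    (T : Module.End K M) (W : Submodule K M) (hT : ∀ w ∈ W, T w ∈ W) (s : Multiset K) :
    ∀ w ∈ W, w ≠ 0 →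
      Polynomial.aeval T (s.map fun a => Polynomial.X - Polynomial.C a).prod w = 0 →
      ∃ v ∈ W, v ≠ 0 ∧ ∃ a : K, T v = a • v := by
  induction s using Multiset.induction_on with
  | empty =>
    intro w _ hw0 h
    exact absurd (by simpa using h) hw0
  | cons a s ih =>
    intro w hw hw0 h
    by_cases h0 : T w - a • w = 0
    · exact ⟨w, hw, hw0, a, sub_eq_zero.1 h0⟩
    · refine ih _ (W.sub_mem (hT w hw) (W.smul_mem a hw)) h0 ?_
      rw [Multiset.map_cons, Multiset.prod_cons, mul_comm, map_mul, Module.End.mul_apply] at h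
      simpa [Module.algebraMap_end_apply] using h

/-- Commuting operators of exponent `p` have a common eigenvector in every nonzero stable
submodule, when `X ^ p - 1` splits. -/
lemma exists_common_eigenvector {K M ι : Type*} [Field K] [AddCommGroup M] [Module K M]
    {p : ℕ} (hp0 : p ≠ 0) (hp : (Polynomial.X ^ p - 1 : Polynomial K).Splits)
    (T : ι → Module.End K M) (hcomm : ∀ i j, Commute (T i) (T j)) (hpow : ∀ i, T i ^ p = 1)
    (W : Submodule K M) (hW : W ≠ ⊥) (hT : ∀ i, ∀ w ∈ W, T i w ∈ W) (s : Finset ι) :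
    ∃ v ∈ W, v ≠ 0 ∧ ∀ i ∈ s, ∃ a : K, T i v = a • v := by
  classical
  induction s using Finset.induction_on with
  | empty =>
    obtain ⟨v, hv, hv0⟩ := W.ne_bot_iff.1 hW
    exact ⟨v, hv, hv0, by simp⟩
  | insert j s _ ih =>
    obtain ⟨v, hv, hv0, hs⟩ := ih
    choose! a ha using hs
    let E : Submodule K M := W ⊓ ⨅ i ∈ s, LinearMap.ker (T i - a i • 1)
    have hE : ∀ w, w ∈ E ↔ w ∈ W ∧ ∀ i ∈ s, T i w = a i • w := by
      intro w
      simp [E, Submodule.mem_iInf, sub_eq_zero]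
    have hprod : (Polynomial.X ^ p - 1 : Polynomial K) =
        ((Polynomial.X ^ p - 1 : Polynomial K).roots.map
          fun a => Polynomial.X - Polynomial.C a).prod := by
      have h := hp.eq_prod_roots
      rwa [Polynomial.leadingCoeff_X_pow_sub_one hp0.bot_lt, Polynomial.C_1, one_mul] at h
    obtain ⟨w, hw, hw0, b, hb⟩ := exists_eigenvector_of_multiset_prod (T j) E
      (by
        intro w hw
        rw [hE] at hw ⊢
        refine ⟨hT j w hw.1, fun i hi => ?_⟩
        have := LinearMap.congr_fun (hcomm i j).eq w
        simp only [Module.End.mul_apply] at this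
        rw [this, hw.2 i hi, map_smul])
      (Polynomial.X ^ p - 1 : Polynomial K).roots v ((hE v).2 ⟨hv, ha⟩) hv0
      (by rw [← hprod]; simp [hpow])
    rw [hE] at hw
    refine ⟨w, hw.1, hw0, fun i hi => ?_⟩
    rcases Finset.mem_insert.1 hi with rfl | hi
    · exact ⟨b, hb⟩
    · exact ⟨a i, hw.2 i hi⟩

/-- Over a finite field, every additive character is a shift of any given nontrivial one. -/
lemma AddChar.exists_eq_mulShift {F K : Type*} [Field F] [Finite F] [Field K]
    {ψ : AddChar F K} (hψ : ψ ≠ 1) (χ : AddChar F K) : ∃ b : F, χ = ψ.mulShift b := by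
  classical
  have := Fintype.ofFinite F
  have hli : LinearIndependent K (fun χ : AddChar F K => (χ : F → K)) :=
    (linearIndependent_monoidHom (Multiplicative F) K).comp
      (AddChar.toMonoidHom : AddChar F K → _) AddChar.toMonoidHomEquiv.injective
  have : Fintype (AddChar F K) := @Fintype.ofFinite _ hli.finite
  have hcard : Fintype.card (AddChar F K) ≤ Fintype.card F := by
    simpa using hli.fintype_card_le_finrank
  have hinj := AddChar.to_mulShift_inj_of_isPrimitive (AddChar.IsPrimitive.of_ne_one hψ)
  have hbij := (Fintype.bijective_iff_injective_and_card ψ.mulShift).2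
    ⟨hinj, le_antisymm (Fintype.card_le_of_injective _ hinj) hcard⟩
  obtain ⟨b, hb⟩ := hbij.2 χ
  exact ⟨b, hb.symm⟩

/-- `X ^ p - 1` splits over a field of characteristic `p` or with a primitive `p`-th root of
unity. -/
lemma X_pow_prime_sub_one_splits {K : Type*} [Field K] {p : ℕ} (hp : p.Prime)
    (hK : ringChar K ≠ p → ∃ ζ : K, IsPrimitiveRoot ζ p) :
    (Polynomial.X ^ p - 1 : Polynomial K).Splits := by
  by_cases h : ringChar K = p
  · have : CharP K p := ringChar.of_eq h
    have := Fact.mk hp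
    have : (Polynomial.X ^ p - 1 : Polynomial K) = (Polynomial.X - Polynomial.C 1) ^ p := by
      rw [sub_pow_char, Polynomial.C_1, one_pow]
    rw [this]
    exact (Polynomial.Splits.X_sub_C 1).pow p
  · obtain ⟨ζ, hζ⟩ := hK h
    exact Polynomial.X_pow_sub_one_splits hζ

/-- An additive character maps finite sums to finite products. -/
lemma AddChar.map_finset_sum_eq_prod {A K ι : Type*} [AddCommMonoid A] [CommMonoid K]
    (χ : AddChar A K) (s : Finset ι) (f : ι → A) : χ (∑ i ∈ s, f i) = ∏ i ∈ s, χ (f i) :=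
  map_prod χ.toMonoidHom (fun i => Multiplicative.ofAdd (f i)) s

section Matrices

variable {F : Type*} [Field F] {n : ℕ}

/-- The transvection `1 + u vᵀ`, where `vᵀ u = 0`. -/
def rankOneUnipotent (u v : Fin n → F) (h : v ⬝ᵥ u = 0) : GL (Fin n) F where
  val := 1 + vecMulVec u v
  inv := 1 - vecMulVec u v
  val_inv := by
    rw [add_mul, one_mul, mul_sub, mul_one, vecMulVec_mul_vecMulVec, h, zero_smul,
      vecMulVec_zero, sub_zero, sub_add_cancel]
  inv_val := by
    rw [sub_mul, one_mul, mul_add, mul_one, vecMulVec_mul_vecMulVec, h, zero_smul,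
      vecMulVec_zero, add_zero, add_sub_cancel_right]

/-- The coordinates of `u` strictly before `k`, extended by zero. -/
def truncate (k : Fin n) (u : Fin n → F) : Fin n → F := fun i => if i < k then u i else 0

lemma truncate_apply_of_lt {k i : Fin n} (h : i < k) (u : Fin n → F) :
    truncate k u i = u i := if_pos h

lemma truncate_apply_of_le {k i : Fin n} (h : k ≤ i) (u : Fin n → F) :
    truncate k u i = 0 := if_neg h.not_gt

lemma truncate_add (k : Fin n) (u v : Fin n → F) :
    truncate k (u + v) = truncate k u + truncate k v := by
  ext i
  simp only [truncate, Pi.add_apply]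
  split_ifs <;> simp

/-- The unipotent matrix that differs from the identity only in column `k`, by the entries of
`u` above the diagonal. -/
def columnUnipotent (k : Fin n) (u : Fin n → F) : GL (Fin n) F :=
  rankOneUnipotent (truncate k u) (Pi.single k 1) (by simp [truncate])

lemma columnUnipotent_val (k : Fin n) (u : Fin n → F) :
    (columnUnipotent k u : Matrix (Fin n) (Fin n) F) =
      1 + vecMulVec (truncate k u) (Pi.single k 1) := rfl

/-- `g` agrees with the identity matrix outside the columns `≤ k` of the rows `< k`. -/
def IsMirabolicBlock (k : ℕ) (g : GL (Fin n) F) : Prop :=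
  ∀ i j : Fin n, k ≤ i.val ∨ k < j.val →
    (g : Matrix (Fin n) (Fin n) F) i j = (1 : Matrix (Fin n) (Fin n) F) i j

lemma IsMirabolicBlock.mono {k l : ℕ} (hkl : k ≤ l) {g : GL (Fin n) F}
    (hg : IsMirabolicBlock k g) : IsMirabolicBlock l g :=
  fun i j h => hg i j (h.imp hkl.trans hkl.trans_lt)

lemma IsMirabolicBlock.mul {k : ℕ} {g h : GL (Fin n) F}
    (hg : IsMirabolicBlock k g) (hh : IsMirabolicBlock k h) : IsMirabolicBlock k (g * h) := by
  intro i j hij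
  rw [Units.val_mul, mul_apply]
  rcases hij with hi | hj
  · rw [Finset.sum_eq_single i
      (fun l _ hl => by rw [hg i l (.inl hi), one_apply_ne hl.symm, zero_mul]) (by simp), hg i i (.inl hi), one_apply_eq, one_mul, hh i j (.inl hi)]
  · rw [Finset.sum_eq_single j
      (fun l _ hl => by rw [hh l j (.inr hj), one_apply_ne hl, mul_zero]) (by simp), hh j j (.inr hj), one_apply_eq, mul_one, hg i j (.inr hj)]

lemma isMirabolicBlock_rankOneUnipotent {k : ℕ} {u v : Fin n → F} (h : v ⬝ᵥ u = 0)
    (hu : ∀ i : Fin n, k ≤ i.val → u i = 0) (hv : ∀ i : Fin n, k < i.val → v i = 0) :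
    IsMirabolicBlock k (rankOneUnipotent u v h) := by
  intro i j hij
  change (1 + vecMulVec u v) i j = _
  rw [Matrix.add_apply, vecMulVec_apply]
  rcases hij with hi | hj
  · rw [hu i hi, zero_mul, add_zero]
  · rw [hv j hj, mul_zero, add_zero]

lemma isMirabolicBlock_columnUnipotent (k : Fin n) (u : Fin n → F) :
    IsMirabolicBlock k.val (columnUnipotent k u) :=
  isMirabolicBlock_rankOneUnipotent _ (fun _ hi => truncate_apply_of_le hi u)
    fun _ hi => Pi.single_eq_of_ne (Fin.ne_of_gt hi) _

lemma columnUnipotent_add (k : Fin n) (u v : Fin n → F) :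
    columnUnipotent k (u + v) = columnUnipotent k u * columnUnipotent k v := by
  apply Units.ext
  rw [Units.val_mul]
  simp only [columnUnipotent_val]
  rw [add_mul, one_mul, mul_add, mul_one, vecMulVec_mul_vecMulVec, truncate_add, add_vecMulVec]
  have : (Pi.single k (1 : F) : Fin n → F) ⬝ᵥ truncate k v = 0 := by simp [truncate]
  rw [this, zero_smul, vecMulVec_zero]
  abel

lemma columnUnipotent_zero (k : Fin n) : columnUnipotent k (0 : Fin n → F) = 1 := by
  simpa using columnUnipotent_add k (0 : Fin n → F) 0

lemma truncate_truncate (k : Fin n) (u : Fin n → F) :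
    truncate k (truncate k u) = truncate k u := by
  ext i
  simp only [truncate]
  split_ifs <;> rfl

lemma columnUnipotent_truncate (k : Fin n) (u : Fin n → F) :
    columnUnipotent k (truncate k u) = columnUnipotent k u := by
  apply Units.ext
  rw [columnUnipotent_val, columnUnipotent_val, truncate_truncate]

lemma IsMirabolicBlock.mulVec_apply {k : ℕ} {g : GL (Fin n) F} (hg : IsMirabolicBlock k g)
    (v : Fin n → F) {i : Fin n} (hi : k ≤ i.val) :
    ((g : Matrix (Fin n) (Fin n) F) *ᵥ v) i = v i := by
  rw [mulVec, dotProduct, Finset.sum_eq_single i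
    (fun l _ hl => by rw [hg i l (.inl hi), one_apply_ne hl.symm, zero_mul]) (by simp),
    hg i i (.inl hi), one_apply_eq, one_mul]

lemma IsMirabolicBlock.inv [Finite F] {k : ℕ} {g : GL (Fin n) F} (hg : IsMirabolicBlock k g) :
    IsMirabolicBlock k g⁻¹ :=
  inv_mem_of_one_mem_of_mul_mem (S := {g | IsMirabolicBlock k g}) (fun _ _ _ => rfl)
    (fun ha hb => IsMirabolicBlock.mul ha hb) hg

/-- Conjugating a column unipotent by a matrix fixing the rows from `k` on. -/
lemma IsMirabolicBlock.exists_columnUnipotent_mul {k : Fin n} {g : GL (Fin n) F}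
    (hg : IsMirabolicBlock k.val g) (u : Fin n → F) :
    ∃ v : Fin n → F, (g : Matrix (Fin n) (Fin n) F) *ᵥ v = truncate k u ∧
      columnUnipotent k u * g = g * columnUnipotent k v := by
  refine ⟨((g⁻¹ : GL (Fin n) F) : Matrix (Fin n) (Fin n) F) *ᵥ truncate k u, ?_, ?_⟩
  · rw [mulVec_mulVec, ← Units.val_mul, mul_inv_cancel, Units.val_one, one_mulVec]
  set v := ((g⁻¹ : GL (Fin n) F) : Matrix (Fin n) (Fin n) F) *ᵥ truncate k u with hv
  have hgv : (g : Matrix (Fin n) (Fin n) F) *ᵥ v = truncate k u := by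
    rw [hv, mulVec_mulVec, ← Units.val_mul, mul_inv_cancel, Units.val_one, one_mulVec]
  have htv : truncate k v = v := by
    ext i
    rcases lt_or_ge i k with h | h
    · exact truncate_apply_of_lt h v
    · rw [truncate_apply_of_le h, ← hg.mulVec_apply v h, hgv, truncate_apply_of_le h]
  have hrow : (Pi.single k (1 : F) : Fin n → F) ᵥ* (g : Matrix (Fin n) (Fin n) F) =
      Pi.single k 1 := by
    ext j
    rw [single_one_vecMul, row_apply, hg k j (.inl le_rfl), one_apply, Pi.single_apply]
    simp only [eq_comm]
  apply Units.ext
  rw [Units.val_mul, Units.val_mul, columnUnipotent_val, columnUnipotent_val, add_mul, mul_add,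
    one_mul, mul_one, vecMulVec_mul, hrow, mul_vecMulVec, htv, hgv]

/-- A unitriangular matrix in the `k`-th block is a column unipotent times one in the previous
block. -/
lemma IsMirabolicBlock.exists_eq_columnUnipotent_mul {F : Type} [Field F] [Fintype F]
    [DecidableEq F] {k : ℕ} (hk : k + 1 < n) {g : GL (Fin n) F}
    (hg : IsMirabolicBlock (k + 1) g) (hU : g ∈ UT F n) :
    ∃ (u : Fin n → F) (h : GL (Fin n) F), IsMirabolicBlock k h ∧ h ∈ UT F n ∧
      g = columnUnipotent ⟨k + 1, hk⟩ u * h := by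
  set K : Fin n := ⟨k + 1, hk⟩
  set u : Fin n → F := fun i => (g : Matrix (Fin n) (Fin n) F) i K
  have hrow : (Pi.single K (1 : F) : Fin n → F) ᵥ* (g : Matrix (Fin n) (Fin n) F) =
      Pi.single K 1 := by
    ext j
    rw [single_one_vecMul, row_apply, hg K j (.inl le_rfl), one_apply, Pi.single_apply]
    simp only [eq_comm]
  have hval : ((columnUnipotent K (-u) * g : GL (Fin n) F) : Matrix (Fin n) (Fin n) F) =
      g + vecMulVec (truncate K (-u)) (Pi.single K 1) := by
    rw [Units.val_mul, columnUnipotent_val, add_mul, one_mul, vecMulVec_mul, hrow]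
  have hne : ∀ i j, j ≠ K → (columnUnipotent K (-u) * g : GL (Fin n) F) i j = g i j := by
    intro i j hj
    rw [hval, Matrix.add_apply, vecMulVec_apply, Pi.single_eq_of_ne hj, mul_zero, add_zero]
  have hcol : ∀ i, (columnUnipotent K (-u) * g : GL (Fin n) F) i K =
      (1 : Matrix (Fin n) (Fin n) F) i K := by
    intro i
    rw [hval, Matrix.add_apply, vecMulVec_apply, Pi.single_eq_same, mul_one]
    rcases lt_or_ge i K with h | h
    · rw [truncate_apply_of_lt h, one_apply_ne h.ne]
      simp [u]
    · rw [truncate_apply_of_le h, add_zero]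
      exact hg i K (.inl h)
  refine ⟨u, columnUnipotent K (-u) * g, ?_, ⟨?_, ?_⟩, ?_⟩
  · intro i j hij
    by_cases hj : j = K
    · rw [hj, hcol]
    rw [hne i j hj]
    by_cases hij' : k + 1 ≤ i.val ∨ k + 1 < j.val
    · exact hg i j hij'
    · have hi : i.val = k := by
        have : j.val ≠ k + 1 := fun h => hj (Fin.ext h)
        omega
      rcases lt_trichotomy i j with h | rfl | h
      · have : j.val ≠ k + 1 := fun h => hj (Fin.ext h)
        have : i.val < j.val := h
        omega
      · rw [hU.2, one_apply_eq]
      · rw [hU.1 (show id j < id i from h), one_apply_ne h.ne']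
  · intro i j hij
    by_cases hj : j = K
    · rw [hj, hcol, one_apply_ne]
      rintro rfl
      exact hij.ne hj
    · rw [hne i j hj]
      exact hU.1 hij
  · intro i
    by_cases hj : i = K
    · rw [hj, hcol, one_apply_eq]
    · rw [hne i i hj, hU.2]
  · rw [← mul_assoc, ← columnUnipotent_add, add_neg_cancel, columnUnipotent_zero, one_mul]

/-- With `k = l + 1`, a vector with an entry `1` before position `k` and zero from there on is
row `l` of an invertible matrix in the `k`-th block. -/
lemma exists_isMirabolicBlock_mulVec_eq {l k : Fin n} (hk : k.val = l.val + 1) (b : Fin n → F)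
    {i₀ : Fin n} (hi₀ : i₀ < k) (hb₀ : b i₀ = 1) (hb : ∀ i, k ≤ i → b i = 0) :
    ∃ g : GL (Fin n) F, IsMirabolicBlock k.val g ∧
      ∀ v, ((g : Matrix (Fin n) (Fin n) F) *ᵥ v) l = b ⬝ᵥ v := by
  have hl : l < k := by rw [Fin.lt_def]; omega
  have huv : (b - Pi.single l 1) ⬝ᵥ
      (Pi.single l 1 + (1 - b l) • Pi.single i₀ 1 : Fin n → F) = 0 := by
    by_cases h : l = i₀
    · subst h
      simp [hb₀]
    · simp [hb₀, dotProduct_add, Ne.symm h]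
  have hul : (Pi.single l 1 + (1 - b l) • Pi.single i₀ 1 : Fin n → F) l = 1 := by
    by_cases h : l = i₀
    · subst h
      simp [hb₀]
    · simp [h]
  refine ⟨rankOneUnipotent _ _ huv, isMirabolicBlock_rankOneUnipotent _ ?_ ?_, fun v => ?_⟩
  · intro i hi
    have h1 : i ≠ l := (hl.trans_le hi).ne'
    have h2 : i ≠ i₀ := (hi₀.trans_le hi).ne'
    simp [h1, h2]
  · intro i hi
    have h1 : i ≠ l := (hl.trans hi).ne'
    simp [h1, hb i hi.le]
  · change ((1 + vecMulVec _ _) *ᵥ v) l = _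
    rw [add_mulVec, one_mulVec, Pi.add_apply, vecMulVec_mulVec, Pi.smul_apply, hul]
    simp [sub_dotProduct]

end Matrices

section Action

variable {F K M : Type*} [Field F] [Finite F] [Field K] [AddCommGroup M] [Module K M]
  {n N p : ℕ} {act : GL (Fin n) F → Module.End K M}

/-- A nonzero submodule stable under the column unipotents of column `k` contains a nonzero vector
on which they act through an additive character. -/
lemma exists_columnUnipotent_eigenvector (hp0 : p ≠ 0) (hpF : (p : F) = 0)
    (hpK : (Polynomial.X ^ p - 1 : Polynomial K).Splits) (hone : act 1 = 1)
    (hmul : ∀ g h, IsMirabolicBlock N g → IsMirabolicBlock N h → act (g * h) = act g * act h)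
    {k : Fin n} (hkN : k.val ≤ N) (W : Submodule K M) (hW : W ≠ ⊥)
    (hstab : ∀ u, ∀ w ∈ W, act (columnUnipotent k u) w ∈ W) :
    ∃ w ∈ W, w ≠ 0 ∧ ∃ χ : AddChar (Fin n → F) K,
      ∀ u, act (columnUnipotent k u) w = χ u • w := by
  classical
  have := Fintype.ofFinite F
  have hc : ∀ u, IsMirabolicBlock N (columnUnipotent (F := F) k u) :=
    fun u => (isMirabolicBlock_columnUnipotent k u).mono hkN
  have hadd : ∀ u v, act (columnUnipotent k (u + v)) =
      act (columnUnipotent k u) * act (columnUnipotent k v) := fun u v => by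
    rw [columnUnipotent_add, hmul _ _ (hc u) (hc v)]
  have hpow : ∀ (m : ℕ) u, act (columnUnipotent k u) ^ m = act (columnUnipotent k (m • u)) := by
    intro m u
    induction m with
    | zero => rw [pow_zero, zero_smul, columnUnipotent_zero, hone]
    | succ m ih => rw [pow_succ, ih, succ_nsmul, hadd]
  obtain ⟨w, hw, hw0, h⟩ := exists_common_eigenvector hp0 hpK
    (fun u => act (columnUnipotent k u))
    (fun u v => by rw [commute_iff_eq, ← hadd, ← hadd, add_comm])
    (fun u => by
      have hpu : p • u = 0 := by
        ext i
        simp [hpF]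
      rw [hpow, hpu, columnUnipotent_zero, hone])
    W hW hstab Finset.univ
  choose χ hχ using fun u => h u (Finset.mem_univ u)
  refine ⟨w, hw, hw0, ⟨χ, ?_, fun u v => ?_⟩, hχ⟩
  · apply smul_left_injective K hw0
    simp only
    rw [← hχ, columnUnipotent_zero, hone, one_smul, Module.End.one_apply]
  · apply smul_left_injective K hw0
    simp only
    rw [← hχ, hadd, Module.End.mul_apply, hχ v, map_smul, hχ u, smul_smul, mul_comm]

/-- Inside a nonzero submodule stable under the block of size `k = l + 1`, some nonzero vector is
an eigenvector of all column unipotents of column `k`, with eigenvalues depending only on the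
entry in row `l`. -/
lemma exists_columnUnipotent_eigenvector_last (hp0 : p ≠ 0) (hpF : (p : F) = 0)
    (hpK : (Polynomial.X ^ p - 1 : Polynomial K).Splits) (hone : act 1 = 1)
    (hmul : ∀ g h, IsMirabolicBlock N g → IsMirabolicBlock N h → act (g * h) = act g * act h)
    {l k : Fin n} (hlk : k.val = l.val + 1) (hkN : k.val ≤ N) (W : Submodule K M) (hW : W ≠ ⊥)
    (hstab : ∀ g, IsMirabolicBlock k.val g → ∀ w ∈ W, act g w ∈ W) :
    ∃ w ∈ W, w ≠ 0 ∧ ∃ θ : F → K, ∀ u, act (columnUnipotent k u) w = θ (u l) • w := by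
  classical
  obtain ⟨w, hw, hw0, χ, hχ⟩ := exists_columnUnipotent_eigenvector hp0 hpF hpK hone hmul hkN W hW
    fun u => hstab _ (isMirabolicBlock_columnUnipotent k u)
  let χi : Fin n → AddChar F K := fun i => χ.compAddMonoidHom (AddMonoidHom.single (fun _ => F) i)
  have hχi : ∀ i x, χi i x = χ (Pi.single i x) := fun i x => rfl
  have hprod : ∀ u, χ u = ∏ i, χi i (u i) := by
    intro u
    simp only [hχi]
    rw [← χ.map_finset_sum_eq_prod, Finset.univ_sum_single]
  have htriv : ∀ i, k ≤ i → χi i = 1 := by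
    intro i hi
    ext x
    have ht : truncate k (Pi.single i x : Fin n → F) = 0 := by
      ext j
      by_cases hj : j < k
      · rw [truncate_apply_of_lt hj, Pi.single_eq_of_ne (hj.trans_le hi).ne, Pi.zero_apply]
      · rw [truncate_apply_of_le (not_lt.1 hj), Pi.zero_apply]
    apply smul_left_injective K hw0
    simp only [AddChar.one_apply]
    rw [hχi, ← hχ, ← columnUnipotent_truncate, ht, columnUnipotent_zero, hone, one_smul,
      Module.End.one_apply]
  by_cases hall : ∀ i, χi i = 1
  · refine ⟨w, hw, hw0, fun _ => 1, fun u => ?_⟩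
    rw [hχ, hprod]
    simp [hall]
  push Not at hall
  obtain ⟨i₀, hi₀⟩ := hall
  have hinj := AddChar.to_mulShift_inj_of_isPrimitive (AddChar.IsPrimitive.of_ne_one hi₀)
  choose b hb using fun i => AddChar.exists_eq_mulShift hi₀ (χi i)
  obtain ⟨g, hg, hgb⟩ := exists_isMirabolicBlock_mulVec_eq hlk b (i₀ := i₀)
    (lt_of_not_ge fun h => hi₀ (htriv i₀ h))
    (hinj (by rw [← hb, AddChar.mulShift_one]))
    (fun i hi => hinj (by rw [← hb, AddChar.mulShift_zero, htriv i hi]))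
  have hgN := hg.mono hkN
  have hχb : ∀ u, χ u = χi i₀ (b ⬝ᵥ u) := by
    intro u
    rw [hprod, dotProduct, AddChar.map_finset_sum_eq_prod]
    exact Finset.prod_congr rfl fun i _ => by rw [hb i, AddChar.mulShift_apply]
  refine ⟨act g w, hstab g hg w hw, fun h0 => ?_, χi i₀, fun u => ?_⟩
  · apply hw0
    have hinv : IsMirabolicBlock N g⁻¹ := hgN.inv
    rw [← Module.End.one_apply (R := K) w, ← hone, ← inv_mul_cancel g, hmul _ _ hinv hgN,
      Module.End.mul_apply, h0, map_zero]
  · obtain ⟨v, hv, hcomm⟩ := hg.exists_columnUnipotent_mul u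
    have hl : l < k := by rw [Fin.lt_def]; omega
    rw [← Module.End.mul_apply,
      ← hmul _ _ ((isMirabolicBlock_columnUnipotent k u).mono hkN) hgN, hcomm,
      hmul _ _ hgN ((isMirabolicBlock_columnUnipotent k v).mono hkN), Module.End.mul_apply, hχ,
      map_smul, hχb, ← hgb, hv, truncate_apply_of_lt hl]

end Action

/-- Every nonzero submodule stable under the block of size `k` contains a nonzero common
eigenvector of the unitriangular matrices in this block. -/
lemma exists_unitriangular_eigenvector {F : Type} [Field F] [Fintype F] [DecidableEq F]
    {K M : Type*} [Field K] [AddCommGroup M] [Module K M]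
    {n N p : ℕ} {act : GL (Fin n) F → Module.End K M} (hp0 : p ≠ 0) (hpF : (p : F) = 0)
    (hpK : (Polynomial.X ^ p - 1 : Polynomial K).Splits) (hone : act 1 = 1)
    (hmul : ∀ g h, IsMirabolicBlock N g → IsMirabolicBlock N h → act (g * h) = act g * act h)
    (k : ℕ) (hkn : k < n) (hkN : k ≤ N) (W : Submodule K M) (hW : W ≠ ⊥)
    (hstab : ∀ g, IsMirabolicBlock k g → ∀ w ∈ W, act g w ∈ W) :
    ∃ w ∈ W, w ≠ 0 ∧ ∀ g, IsMirabolicBlock k g → g ∈ UT F n → ∃ a : K, act g w = a • w := by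
  induction k generalizing W with
  | zero =>
    obtain ⟨w, hw, hw0⟩ := W.ne_bot_iff.1 hW
    refine ⟨w, hw, hw0, fun g hg _ => ⟨1, ?_⟩⟩
    have : g = 1 := Units.ext (Matrix.ext fun i j => hg i j (.inl (Nat.zero_le _)))
    rw [this, hone, one_smul, Module.End.one_apply]
  | succ k ih =>
    let l : Fin n := ⟨k, by omega⟩
    let c : (Fin n → F) → GL (Fin n) F := columnUnipotent ⟨k + 1, hkn⟩
    have hc : ∀ u, IsMirabolicBlock N (c u) :=
      fun u => (isMirabolicBlock_columnUnipotent ⟨k + 1, hkn⟩ u).mono hkN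
    obtain ⟨v, hv, hv0, θ, hθ⟩ := exists_columnUnipotent_eigenvector_last hp0 hpF hpK hone hmul
      (l := l) (k := ⟨k + 1, hkn⟩) rfl hkN W hW hstab
    let E : Submodule K M := W ⊓ ⨅ u, LinearMap.ker (act (c u) - θ (u l) • 1)
    have hE : ∀ w, w ∈ E ↔ w ∈ W ∧ ∀ u, act (c u) w = θ (u l) • w := by
      intro w
      simp [E, Submodule.mem_iInf, sub_eq_zero]
    obtain ⟨w, hw, hw0, h⟩ := ih (by omega) (by omega) E
      (E.ne_bot_iff.2 ⟨v, (hE v).2 ⟨hv, hθ⟩, hv0⟩) (by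
        intro g hg w hw
        rw [hE] at hw ⊢
        have hg' : IsMirabolicBlock (k + 1) g := hg.mono k.le_succ
        refine ⟨hstab g hg' w hw.1, fun u => ?_⟩
        obtain ⟨v, hv, hcomm⟩ :=
          IsMirabolicBlock.exists_columnUnipotent_mul (k := ⟨k + 1, hkn⟩) hg' u
        have hl : v l = u l := by
          rw [← hg.mulVec_apply v (i := l) le_rfl, hv, truncate_apply_of_lt]
          exact Nat.lt_succ_self k
        rw [← Module.End.mul_apply, ← hmul _ _ (hc u) (hg'.mono hkN), hcomm,
          hmul _ _ (hg'.mono hkN) (hc v), Module.End.mul_apply, hw.2, map_smul, hl])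
    rw [hE] at hw
    refine ⟨w, hw.1, hw0, fun g hg hU => ?_⟩
    obtain ⟨u, g', hg', hU', rfl⟩ := hg.exists_eq_columnUnipotent_mul hkn hU
    obtain ⟨a, ha⟩ := h g' hg' hU'
    refine ⟨a * θ (u l), ?_⟩
    rw [hmul _ _ (hc u) (hg'.mono (k.le_succ.trans hkN)), Module.End.mul_apply, ha, map_smul,
      hw.2, smul_smul]

/-- Every nonzero module over `K` for the mirabolic-type subgroup
`A(n) ≤ GL_n(F_q)` has a one-dimensional `K`-subspace invariant under `U(n) ⊆ A(n)`. -/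
theorem statement_1
    (p m q : ℕ) (hp : p.Prime) (hm : 0 < m) (hq : q = p ^ m)
    (F : Type) [Field F] [Fintype F] [DecidableEq F] (hF : Fintype.card F = q)
    (n : ℕ) (hn : 2 ≤ n)
    (K : Type) [Field K] (hK : ringChar K ≠ p → ∃ ζ : K, IsPrimitiveRoot ζ p)
    (M : Type) [AddCommGroup M] [Module K M]
    [Module (MonoidAlgebra K (AnSub F n)) M]
    [IsScalarTower K (MonoidAlgebra K (AnSub F n)) M]
    (hM : Nontrivial M) :
    ∃ L : Submodule K M, (∃ v : M, v ≠ 0 ∧ L = Submodule.span K {v}) ∧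
      ∀ u : (UT F n), ∀ x ∈ L,
        (MonoidAlgebra.of K (AnSub F n)
          (⟨(u : GL (Fin n) F), UT_le_AnSub F n u.2⟩ : (AnSub F n))) • x ∈ L := by
  classical
  let ρ : AnSub F n →* Module.End K M :=
    (Algebra.lsmul K K M : MonoidAlgebra K (AnSub F n) →ₐ[K] Module.End K M).toMonoidHom.comp
      (MonoidAlgebra.of K (AnSub F n))
  let act : GL (Fin n) F → Module.End K M :=
    fun g => if hg : g ∈ AnSub F n then ρ ⟨g, hg⟩ else 1
  have hact : ∀ g (hg : g ∈ AnSub F n), act g = ρ ⟨g, hg⟩ := fun g hg => dif_pos hg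
  have hblock : ∀ g : GL (Fin n) F, IsMirabolicBlock (n - 1) g ↔ g ∈ AnSub F n := by
    intro g
    refine ⟨fun hg i j hi => hg i j (.inl hi.ge), fun hg i j hij => hg i j ?_⟩
    have := i.isLt
    have := j.isLt
    omega
  have hpF : (p : F) = 0 := by
    have h : ((p ^ m : ℕ) : F) = 0 := by rw [← hq, ← hF, Nat.cast_card_eq_zero]
    rw [Nat.cast_pow] at h
    exact eq_zero_of_pow_eq_zero h
  obtain ⟨w, -, hw0, h⟩ := exists_unitriangular_eigenvector (act := act) (N := n - 1)
    hp.ne_zero hpF (X_pow_prime_sub_one_splits hp hK)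
    (by rw [hact 1 (one_mem _)]; exact map_one ρ)
    (fun g g' hg hg' => by
      rw [hblock] at hg hg'
      rw [hact _ hg, hact _ hg', hact _ (mul_mem hg hg'), ← map_mul]
      rfl)
    (n - 1) (by omega) le_rfl ⊤ top_ne_bot (fun _ _ _ _ => Submodule.mem_top)
  refine ⟨Submodule.span K {w}, ⟨w, hw0, rfl⟩, fun u x hx => ?_⟩
  obtain ⟨c, rfl⟩ := Submodule.mem_span_singleton.1 hx
  have hu : (u : GL (Fin n) F) ∈ AnSub F n := UT_le_AnSub F n u.2
  obtain ⟨a, ha⟩ := h u ((hblock _).2 hu) u.2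
  rw [hact _ hu] at ha
  change ρ ⟨u, hu⟩ (c • w) ∈ _
  rw [map_smul, ha]
  exact Submodule.smul_mem _ _ (Submodule.smul_mem _ _ (Submodule.mem_span_singleton_self w))
end

section
/- Let p be a prime, q a power of p, n ≥ 1, G = GL_n(F_q), and U ≤ G the subgroup of upper unitriangular matrices. Let K be a field which, in case its characteristic is different from p, contains a primitive p-th root of unity. Let M be a nonzero KG-module possessing a one-dimensional U-invariant subspace L that is contained in the KG-submodule generated by every one-dimensional U-invariant subspace of M. Then the socle of M is irreducible and equals the KG-submodule generated by L; consequently M is irreducible if and only if M is completely reducible. -/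
open Matrix

/-- A `KG`-module `M` (over a field `K`) is *self-dual* if it is isomorphic, as a
`KG`-module, to its dual space `M* = Hom_K(M, K)` equipped with the contragredient
action `(g·φ)(m) = φ(g⁻¹ m)`. -/
def IsSelfDualK (K G : Type*) [Field K] [Group G] (M : Type*) [AddCommGroup M]
    [Module K M] [Module (MonoidAlgebra K G) M]
    [IsScalarTower K (MonoidAlgebra K G) M] : Prop :=
  ∃ φ : M ≃ₗ[K] Module.Dual K M,
    ∀ (g : G) (m x : M),
      φ ((MonoidAlgebra.of K G g) • m) x = φ m ((MonoidAlgebra.of K G g⁻¹) • x)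

/-- The socle of a `KG`-module: the sum of all its irreducible submodules. -/
def socleMod (A M : Type*) [Ring A] [AddCommGroup M] [Module A M] : Submodule A M :=
  sSup {S : Submodule A M | IsSimpleModule A S}

section CommonEigenvectors

variable {K M : Type*} [Field K] [AddCommGroup M] [Module K M]

open Polynomial in
/-- An endomorphism annihilated by a split polynomial has an eigenvector in every nonzero
invariant subspace. -/
lemma exists_eigenvector_mem_of_splits {P : K[X]} (hP : P.Splits) (hP0 : P ≠ 0)
    {f : Module.End K M} (hf : aeval f P = 0) {W : Submodule K M} (hW : W ≠ ⊥)
    (hWf : ∀ w ∈ W, f w ∈ W) : ∃ c : K, ∃ v ∈ W, v ≠ 0 ∧ f v = c • v := by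
  have key : ∀ s : Multiset K, ∀ v ∈ W, v ≠ 0 →
      aeval f (s.map fun a => X - C a).prod v = 0 → ∃ c : K, ∃ v ∈ W, v ≠ 0 ∧ f v = c • v := by
    intro s
    induction s using Multiset.induction_on with
    | empty => intro v _ hv0 h; exact absurd (by simpa using h) hv0
    | cons a s ih =>
      intro v hv hv0 h
      by_cases hz : f v - a • v = 0
      · exact ⟨a, v, hv, hv0, sub_eq_zero.mp hz⟩
      · refine ih _ (W.sub_mem (hWf v hv) (W.smul_mem a hv)) hz ?_
        rw [Multiset.map_cons, Multiset.prod_cons, mul_comm, map_mul] at h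
        simpa [Module.algebraMap_end_apply] using h
  obtain ⟨v, hv, hv0⟩ := W.exists_mem_ne_zero_of_ne_bot hW
  refine key P.roots v hv hv0 ?_
  have h := congrArg (fun g : Module.End K M => g v) hf
  rw [hP.eq_prod_roots, map_mul] at h
  simpa [Module.algebraMap_end_apply, hP0] using h

open Polynomial in
/-- A finite family of commuting endomorphisms, each annihilated by a split polynomial `P`, has a
common eigenvector in every nonzero invariant subspace. -/
lemma exists_common_eigenvector_mem {ι : Type*} {P : K[X]} (hP : P.Splits) (hP0 : P ≠ 0)
    (f : ι → Module.End K M) (hcomm : ∀ i j, Commute (f i) (f j))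
    (hf : ∀ i, aeval (f i) P = 0) (s : Finset ι) :
    ∀ W : Submodule K M, W ≠ ⊥ → (∀ i, ∀ w ∈ W, f i w ∈ W) →
      ∃ v ∈ W, v ≠ 0 ∧ ∀ i ∈ s, ∃ c : K, f i v = c • v := by
  classical
  induction s using Finset.induction_on with
  | empty =>
    intro W hW _
    obtain ⟨v, hv, hv0⟩ := W.exists_mem_ne_zero_of_ne_bot hW
    exact ⟨v, hv, hv0, by simp⟩
  | insert a s _ ih =>
    intro W hW hWf
    obtain ⟨c, v, hv, hv0, hvc⟩ := exists_eigenvector_mem_of_splits hP hP0 (hf a) hW (hWf a)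
    obtain ⟨w, hw, hw0, hws⟩ := ih (W ⊓ (f a).eigenspace c)
      ((Submodule.ne_bot_iff _).mpr ⟨v, ⟨hv, Module.End.mem_eigenspace_iff.mpr hvc⟩, hv0⟩)
      (fun i w hw => ⟨hWf i w hw.1, by
        rw [SetLike.mem_coe, Module.End.mem_eigenspace_iff]
        have h1 : f a (f i w) = f i (f a w) := LinearMap.congr_fun (hcomm a i) w
        rw [h1, Module.End.mem_eigenspace_iff.mp hw.2, map_smul]⟩)
    refine ⟨w, hw.1, hw0, fun i hi => ?_⟩
    rcases Finset.mem_insert.mp hi with rfl | hi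
    · exact ⟨c, Module.End.mem_eigenspace_iff.mp hw.2⟩
    · exact hws i hi

open Polynomial in
lemma splits_X_pow_sub_one_of_ringChar {p : ℕ} (hp : p.Prime)
    (hK : ringChar K ≠ p → ∃ ζ : K, IsPrimitiveRoot ζ p) : (X ^ p - 1 : K[X]).Splits := by
  by_cases h : ringChar K = p
  · have : Fact p.Prime := ⟨hp⟩
    have : CharP K p := h ▸ ringChar.charP K
    have : (X ^ p - 1 : K[X]) = (X - C 1) ^ p := by rw [sub_pow_char]; simp
    rw [this]
    exact (Splits.X_sub_C 1).pow p
  · obtain ⟨ζ, hζ⟩ := hK h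
    exact X_pow_sub_one_splits hζ

end CommonEigenvectors

section AdditiveCharacters

variable {F K : Type*} [Field F] [Finite F] [Field K]

/-- Every additive character of a finite field is a multiplicative shift of any given nontrivial
one. -/
lemma AddChar.mulShift_surjective_of_ne_one {ψ : AddChar F K} (hψ : ψ ≠ 1) :
    Function.Surjective ψ.mulShift := by
  classical
  cases nonempty_fintype F
  have hli : LinearIndependent K (fun χ : AddChar F K => (χ : F → K)) :=
    (linearIndependent_monoidHom (Multiplicative F) K).comp (fun χ : AddChar F K => χ.toMonoidHom)
      (fun χ₁ χ₂ h => by ext x; exact DFunLike.congr_fun h (Multiplicative.ofAdd x))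
  have : Finite (AddChar F K) := hli.finite
  cases nonempty_fintype (AddChar F K)
  have hcard : Fintype.card (AddChar F K) ≤ Fintype.card F := by
    simpa using hli.fintype_card_le_finrank
  have hinj := AddChar.to_mulShift_inj_of_isPrimitive (AddChar.IsPrimitive.of_ne_one hψ)
  exact ((Fintype.bijective_iff_injective_and_card _).mpr
    ⟨hinj, le_antisymm (Fintype.card_le_of_injective _ hinj) hcard⟩).2

lemma AddChar.map_finset_sum {A R ι : Type*} [AddCommMonoid A] [CommMonoid R] (χ : AddChar A R)
    (f : ι → A) (s : Finset ι) : χ (∑ i ∈ s, f i) = ∏ i ∈ s, χ (f i) := by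
  classical
  induction s using Finset.induction_on with
  | empty => simp
  | insert a s ha ih => rw [Finset.sum_insert ha, Finset.prod_insert ha, map_add_eq_mul, ih]

/-- Relative to a nontrivial character `ψ` of a finite field `F`, every additive character of
`ι → F` is of the form `a ↦ ψ (l ⬝ᵥ a)`. -/
lemma AddChar.exists_eq_dotProduct {ι : Type*} [Fintype ι] {ψ : AddChar F K} (hψ : ψ ≠ 1)
    (χ : AddChar (ι → F) K) : ∃ l : ι → F, ∀ a, χ a = ψ (l ⬝ᵥ a) := by
  classical
  have h : ∀ i, ∃ c : F, ∀ x, χ (Pi.single i x) = ψ (c * x) := fun i => by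
    obtain ⟨c, hc⟩ := mulShift_surjective_of_ne_one hψ
      (χ.compAddMonoidHom (AddMonoidHom.single (fun _ => F) i))
    exact ⟨c, fun x => by simpa [AddChar.mulShift_apply] using (DFunLike.congr_fun hc x).symm⟩
  choose l hl using h
  refine ⟨l, fun a => ?_⟩
  conv_lhs => rw [← Finset.univ_sum_single a]
  rw [dotProduct, map_finset_sum, map_finset_sum]
  exact Finset.prod_congr rfl fun i _ => hl i _

end AdditiveCharacters

section ColumnShears

variable {F : Type*} [Field F] {n : ℕ}

/-- The coordinates of a vector strictly above position `k`, the others being replaced by `0`. -/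
def truncateAt (k : Fin n) (a : Fin n → F) : Fin n → F := fun i => if i < k then a i else 0

lemma truncateAt_of_lt {k i : Fin n} (h : i < k) (a : Fin n → F) : truncateAt k a i = a i :=
  if_pos h

lemma truncateAt_of_le {k i : Fin n} (h : k ≤ i) (a : Fin n → F) : truncateAt k a i = 0 :=
  if_neg h.not_gt

lemma truncateAt_add (k : Fin n) (a b : Fin n → F) :
    truncateAt k (a + b) = truncateAt k a + truncateAt k b := by
  ext i; by_cases h : i < k <;> simp [truncateAt, h]

lemma truncateAt_eq_self {k : Fin n} {a : Fin n → F} (h : ∀ i, k ≤ i → a i = 0) :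
    truncateAt k a = a := by
  ext i
  rcases lt_or_ge i k with hi | hi
  · exact truncateAt_of_lt hi a
  · rw [truncateAt_of_le hi, h i hi]

lemma dotProduct_truncateAt {k : Fin n} {l : Fin n → F} (hl : ∀ i, k ≤ i → l i = 0)
    (a : Fin n → F) : l ⬝ᵥ truncateAt k a = l ⬝ᵥ a := by
  refine Finset.sum_congr rfl fun i _ => ?_
  rcases lt_or_ge i k with hi | hi
  · rw [truncateAt_of_lt hi]
  · rw [hl i hi, zero_mul, zero_mul]

lemma one_add_vecMulVec_truncateAt_mul (k : Fin n) (a b : Fin n → F) :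
    (1 + vecMulVec (truncateAt k a) (Pi.single k 1)) *
      (1 + vecMulVec (truncateAt k b) (Pi.single k 1)) =
    (1 + vecMulVec (truncateAt k (a + b)) (Pi.single k 1) : Matrix (Fin n) (Fin n) F) := by
  rw [truncateAt_add, add_vecMulVec, mul_add, mul_one, add_mul, one_mul,
    vecMulVec_mul_vecMulVec, single_dotProduct, truncateAt_of_le le_rfl]
  simp [add_assoc]

/-- The unitriangular matrix adding to the `k`-th column of the identity matrix the entries of `a`
above the diagonal. -/
def colShear (k : Fin n) (a : Fin n → F) : GL (Fin n) F where
  val := 1 + vecMulVec (truncateAt k a) (Pi.single k 1)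
  inv := 1 + vecMulVec (truncateAt k (-a)) (Pi.single k 1)
  val_inv := by
    rw [one_add_vecMulVec_truncateAt_mul]
    ext; simp [vecMulVec_apply, truncateAt]
  inv_val := by
    rw [one_add_vecMulVec_truncateAt_mul]
    ext; simp [vecMulVec_apply, truncateAt]

lemma coe_colShear (k : Fin n) (a : Fin n → F) :
    (colShear k a : Matrix (Fin n) (Fin n) F) = 1 + vecMulVec (truncateAt k a) (Pi.single k 1) :=
  rfl

lemma colShear_add (k : Fin n) (a b : Fin n → F) :
    colShear k (a + b) = colShear k a * colShear k b :=
  Units.ext (one_add_vecMulVec_truncateAt_mul k a b).symm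

lemma colShear_zero (k : Fin n) : colShear k (0 : Fin n → F) = 1 := by
  ext; simp [coe_colShear, vecMulVec_apply, truncateAt]

lemma colShear_pow (k : Fin n) (a : Fin n → F) (m : ℕ) :
    colShear k a ^ m = colShear k (m • a) := by
  induction m with
  | zero => simp [colShear_zero]
  | succ m ih => rw [pow_succ, ih, succ_nsmul, colShear_add]

lemma colShear_apply (k : Fin n) (a : Fin n → F) (i j : Fin n) :
    (colShear k a : Matrix (Fin n) (Fin n) F) i j =
      (1 : Matrix (Fin n) (Fin n) F) i j + if j = k ∧ i < k then a i else 0 := by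
  rcases eq_or_ne j k with rfl | hj
  · simp [coe_colShear, vecMulVec_apply, truncateAt]
  · simp [coe_colShear, vecMulVec_apply, hj]

/-- Conjugating a column shear by a matrix whose rows from the `k`-th on are those of the
identity. -/
lemma mul_colShear {k : Fin n} {g : GL (Fin n) F}
    (hg : ∀ i, k ≤ i → (g : Matrix (Fin n) (Fin n) F).row i = Pi.single i 1)
    {a b : Fin n → F} (hab : (g : Matrix (Fin n) (Fin n) F) *ᵥ b = truncateAt k a) :
    g * colShear k b = colShear k a * g := by
  have hb : ∀ i, k ≤ i → b i = 0 := fun i hi => by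
    have h : (g : Matrix (Fin n) (Fin n) F).row i ⬝ᵥ b = truncateAt k a i := congrFun hab i
    rw [truncateAt_of_le hi, hg i hi] at h
    simpa using h
  apply Units.ext
  rw [Units.val_mul, Units.val_mul, coe_colShear, coe_colShear, mul_add, add_mul, mul_one, one_mul,
    mul_vecMulVec, vecMulVec_mul, single_one_vecMul, hg k le_rfl, truncateAt_eq_self hb, hab]

/-- The invertible matrices that agree with the identity matrix in the columns with (zero-based)
index at least `k` and in the rows with index at least `k - 1`: a copy of the mirabolic subgroup
of `GL_k`. -/
def IsMirabolic (k : ℕ) (g : GL (Fin n) F) : Prop :=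
  (∀ j : Fin n, k ≤ j → (g : Matrix (Fin n) (Fin n) F).col j = Pi.single j 1) ∧
    ∀ i : Fin n, k ≤ i + 1 → (g : Matrix (Fin n) (Fin n) F).row i = Pi.single i 1

lemma IsMirabolic.succ {k : ℕ} {g : GL (Fin n) F} (hg : IsMirabolic k g) :
    IsMirabolic (k + 1) g :=
  ⟨fun j hj => hg.1 j (by omega), fun i hi => hg.2 i (by omega)⟩

lemma isMirabolic_colShear (k : Fin n) (a : Fin n → F) : IsMirabolic (k + 1) (colShear k a) := by
  refine ⟨fun j hj => ?_, fun i hi => ?_⟩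
  · ext i
    have : j ≠ k := by rintro rfl; omega
    simp [colShear_apply, this, one_apply, Pi.single_apply]
  · ext j
    have : ¬ i < k := by rw [Fin.lt_def]; omega
    simp [colShear_apply, this, one_apply, Pi.single_apply, eq_comm]

/-- A nonzero row vector supported on positions below `k` is the row of index `r = k - 1` of some
matrix in the mirabolic subgroup of index `k + 1`. -/
lemma exists_isMirabolic_single_vecMul_eq {k r : Fin n} (hr : (r : ℕ) + 1 = k) {l : Fin n → F}
    (hl : ∀ i, k ≤ i → l i = 0) (hl0 : l ≠ 0) :
    ∃ g : GL (Fin n) F, IsMirabolic (k + 1) g ∧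
      Pi.single r 1 ᵥ* (g : Matrix (Fin n) (Fin n) F) = l := by
  obtain ⟨u, hur, huk, hlu⟩ : ∃ u : Fin n → F, u r = 1 ∧ (∀ i, k ≤ i → u i = 0) ∧ l ⬝ᵥ u ≠ 0 := by
    have hrk : r < k := by rw [Fin.lt_def]; omega
    by_cases hlr : l r = 0
    · obtain ⟨i, hi⟩ := Function.ne_iff.mp hl0
      have hir : r ≠ i := by rintro rfl; exact hi hlr
      have hik : i < k := by by_contra h; exact hi (hl i (not_lt.mp h))
      refine ⟨Pi.single r 1 + Pi.single i 1, by simp [hir], fun j hj => ?_, ?_⟩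
      · simp [(hrk.trans_le hj).ne', (hik.trans_le hj).ne']
      · simpa [dotProduct_add, hlr] using hi
    · exact ⟨Pi.single r 1, by simp, fun j hj => by simp [(hrk.trans_le hj).ne'], by simpa using hlr⟩
  have hdet : (1 + vecMulVec u (l - Pi.single r 1)).det = l ⬝ᵥ u := by
    rw [vecMulVec_eq Unit, det_one_add_replicateCol_mul_replicateRow, sub_dotProduct,
      single_dotProduct, hur]
    ring
  refine ⟨GeneralLinearGroup.mkOfDetNeZero (1 + vecMulVec u (l - Pi.single r 1)) (hdet ▸ hlu),
    ⟨fun j hj => ?_, fun i hi => ?_⟩, ?_⟩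
  · have h1 : l j = 0 := hl j (by rw [Fin.le_def]; omega)
    have h2 : j ≠ r := by rintro rfl; omega
    ext i
    simp [GeneralLinearGroup.mkOfDetNeZero, vecMulVec_apply, h1, h2, one_apply, Pi.single_apply]
  · have h1 : u i = 0 := huk i (by rw [Fin.le_def]; omega)
    ext j
    simp [GeneralLinearGroup.mkOfDetNeZero, vecMulVec_apply, h1, one_apply, Pi.single_apply,
      eq_comm]
  · ext j
    simp [GeneralLinearGroup.mkOfDetNeZero, vecMulVec_apply, hur, one_apply, Pi.single_apply,
      eq_comm]

end ColumnShears

section Unitriangular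

variable {F : Type} [Field F] [Fintype F] {n : ℕ}

lemma isMirabolic_of_mem_UT {k : ℕ} {u : GL (Fin n) F} (hu : u ∈ UT F n)
    (hcol : ∀ j : Fin n, k ≤ j → (u : Matrix (Fin n) (Fin n) F).col j = Pi.single j 1) :
    IsMirabolic k u := by
  refine ⟨hcol, fun i hi => ?_⟩
  ext j
  rcases lt_trichotomy j i with h | rfl | h
  · simpa [h.ne] using hu.1 h
  · simpa using hu.2 j
  · have := congrFun (hcol j (by rw [Fin.lt_def] at h; omega)) i
    simpa [h.ne, h.ne'] using this

lemma colShear_mem_UT (k : Fin n) (a : Fin n → F) : colShear k a ∈ UT F n := by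
  refine ⟨fun i j hij => ?_, fun i => ?_⟩
  · have hij : j < i := hij
    have : ¬ (j = k ∧ i < k) := by rintro ⟨rfl, h⟩; exact lt_asymm h hij
    simp [colShear_apply, this, hij.ne']
  · have : ¬ (i = k ∧ i < k) := by rintro ⟨rfl, h⟩; exact lt_irrefl _ h
    simp [colShear_apply, this]

/-- A unitriangular matrix in one mirabolic subgroup is the product of a column shear and a
unitriangular matrix in the previous mirabolic subgroup. -/
lemma exists_colShear_mul_eq {k : Fin n} {u : GL (Fin n) F} (hu : u ∈ UT F n)
    (hu' : IsMirabolic (k + 1) u) :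
    ∃ a : Fin n → F, ∃ u' ∈ UT F n, IsMirabolic k u' ∧ u = colShear k a * u' := by
  set a : Fin n → F := (u : Matrix (Fin n) (Fin n) F).col k with ha
  have hmem : (colShear k a)⁻¹ * u ∈ UT F n :=
    (UT F n).mul_mem ((UT F n).inv_mem (colShear_mem_UT k a)) hu
  refine ⟨a, _, hmem, isMirabolic_of_mem_UT hmem fun j hj => ?_, (mul_inv_cancel_left _ _).symm⟩
  have hcol : (u : Matrix (Fin n) (Fin n) F).col j =
      (colShear k a : Matrix (Fin n) (Fin n) F) *ᵥ Pi.single j 1 := by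
    rw [mulVec_single_one]
    rcases eq_or_ne j k with rfl | hjk
    · ext i
      rcases lt_trichotomy i j with h | rfl | h
      · simp [colShear_apply, h, h.ne, ha]
      · simpa [colShear_apply] using hu.2 i
      · simpa [colShear_apply, h.ne', h.not_gt] using hu.1 h
    · have hj' : (k : ℕ) + 1 ≤ j := by have := Fin.val_ne_of_ne hjk; omega
      rw [hu'.1 j hj', (isMirabolic_colShear k a).1 j hj']
  rw [Units.val_mul, ← mulVec_single_one, ← mulVec_mulVec, mulVec_single_one, hcol, mulVec_mulVec,
    ← Units.val_mul, inv_mul_cancel, Units.val_one, one_mulVec]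

end Unitriangular

section ShearWeightSpaces

variable {F K M : Type*} [Field F] [Field K] [AddCommGroup M] [Module K M] {n : ℕ}

/-- The vectors on which the column shears at `k` act through the character `a ↦ ψ (l ⬝ᵥ a)`. -/
def shearWeightSpace (ρ : Representation K (GL (Fin n) F) M) (k : Fin n) (ψ : AddChar F K)
    (l : Fin n → F) : Submodule K M :=
  ⨅ a, Module.End.eigenspace (ρ (colShear k a)) (ψ (l ⬝ᵥ a))

lemma mem_shearWeightSpace {ρ : Representation K (GL (Fin n) F) M} {k : Fin n} {ψ : AddChar F K}
    {l : Fin n → F} {v : M} :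
    v ∈ shearWeightSpace ρ k ψ l ↔ ∀ a, ρ (colShear k a) v = ψ (l ⬝ᵥ a) • v := by
  simp [shearWeightSpace]

lemma map_mem_shearWeightSpace {ρ : Representation K (GL (Fin n) F) M} {k : Fin n}
    {ψ : AddChar F K} {l : Fin n → F} (hl : ∀ i, k ≤ i → l i = 0) {g : GL (Fin n) F}
    (hg : IsMirabolic (k + 1) g) {v : M}
    (hv : v ∈ shearWeightSpace ρ k ψ (l ᵥ* (g : Matrix (Fin n) (Fin n) F))) :
    ρ g v ∈ shearWeightSpace ρ k ψ l := by
  rw [mem_shearWeightSpace] at hv ⊢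
  intro a
  set b := ((g⁻¹ : GL (Fin n) F) : Matrix (Fin n) (Fin n) F) *ᵥ truncateAt k a with hb
  have hab : (g : Matrix (Fin n) (Fin n) F) *ᵥ b = truncateAt k a := by
    rw [hb, mulVec_mulVec, ← Units.val_mul, mul_inv_cancel, Units.val_one, one_mulVec]
  have hconj := mul_colShear (fun i hi => hg.2 i (by rw [Fin.le_def] at hi; omega)) hab
  rw [← Module.End.mul_apply, ← map_mul, ← hconj, map_mul, Module.End.mul_apply, hv, map_smul,
    ← dotProduct_mulVec, hab, dotProduct_truncateAt hl]

/-- Every nonzero subspace stable under a mirabolic subgroup meets a weight space of the column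
shears whose weight is fixed by the previous mirabolic subgroup. -/
lemma exists_inf_shearWeightSpace_ne_bot [Finite F] {p : ℕ} (hp : p ≠ 0) (hpF : (p : F) = 0)
    (hsplit : (Polynomial.X ^ p - 1 : Polynomial K).Splits)
    (ρ : Representation K (GL (Fin n) F) M) (k : Fin n) {W : Submodule K M} (hW : W ≠ ⊥)
    (hWρ : ∀ g, IsMirabolic (k + 1) g → ∀ w ∈ W, ρ g w ∈ W) :
    ∃ ψ : AddChar F K, ∃ l : Fin n → F, (∀ i, k ≤ i → l i = 0) ∧
      (∀ g : GL (Fin n) F, IsMirabolic k g → l ᵥ* (g : Matrix (Fin n) (Fin n) F) = l) ∧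
      W ⊓ shearWeightSpace ρ k ψ l ≠ ⊥ := by
  classical
  cases nonempty_fintype F
  obtain ⟨v, hv, hv0, hev⟩ := exists_common_eigenvector_mem hsplit
    (Polynomial.X_pow_sub_C_ne_zero (Nat.pos_of_ne_zero hp) 1)
    (fun a => ρ (colShear k a))
    (fun a b => by
      rw [commute_iff_eq, ← map_mul, ← map_mul, ← colShear_add, ← colShear_add, add_comm])
    (fun a => by
      have : p • a = 0 := by ext i; simp [hpF]
      rw [map_sub, map_pow, Polynomial.aeval_X, map_one, ← map_pow, colShear_pow, this,
        colShear_zero, map_one, sub_self])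
    Finset.univ W hW (fun a => hWρ _ (isMirabolic_colShear k a))
  choose c hc using fun a => hev a (Finset.mem_univ a)
  have inj : ∀ {x y : K}, x • v = y • v → x = y := fun h => smul_left_injective K hv0 h
  let χ : AddChar (Fin n → F) K :=
    { toFun := c
      map_zero_eq_one' := inj (by rw [← hc, colShear_zero, map_one, one_smul]; rfl)
      map_add_eq_mul' := fun a b => inj (by
        rw [← hc, colShear_add, map_mul, Module.End.mul_apply, hc b, map_smul, hc a, smul_smul,
          mul_comm]) }
  have hχ : ∀ a, ρ (colShear k a) v = χ a • v := hc
  by_cases hχ1 : χ = 1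
  · refine ⟨1, 0, fun _ _ => rfl, fun g _ => zero_vecMul _,
      (Submodule.ne_bot_iff _).mpr ⟨v, ⟨hv, mem_shearWeightSpace.mpr fun a => ?_⟩, hv0⟩⟩
    rw [hχ, hχ1, AddChar.one_apply, AddChar.one_apply]
  obtain ⟨ψ, hψ⟩ : ∃ ψ : AddChar F K, ψ ≠ 1 := by
    obtain ⟨a, ha⟩ := AddChar.ne_one_iff.mp hχ1
    by_contra! h
    refine ha ?_
    rw [← Finset.univ_sum_single a, AddChar.map_finset_sum]
    exact Finset.prod_eq_one fun i _ =>
      DFunLike.congr_fun (h (χ.compAddMonoidHom (AddMonoidHom.single (fun _ => F) i))) (a i)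
  obtain ⟨l, hl⟩ := AddChar.exists_eq_dotProduct hψ χ
  have hlk : ∀ i, k ≤ i → l i = 0 := fun i hi => by
    by_contra hli
    refine AddChar.IsPrimitive.of_ne_one hψ hli ?_
    ext x
    rw [AddChar.mulShift_apply, AddChar.one_apply]
    refine inj ?_
    have : colShear k (Pi.single i x : Fin n → F) = colShear k 0 := by
      ext r s
      simp only [colShear_apply, Pi.zero_apply, ite_self, add_zero, add_eq_left,
        ite_eq_right_iff, and_imp]
      exact fun _ hr => Pi.single_eq_of_ne (hr.trans_le hi).ne _
    rw [← dotProduct_single, ← hl, ← hχ, this, colShear_zero, map_one, one_smul]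
    rfl
  have hl0 : l ≠ 0 := by
    rintro rfl
    exact hχ1 (by ext a; simp [hl])
  obtain ⟨r, hr⟩ : ∃ r : Fin n, (r : ℕ) + 1 = k := by
    obtain ⟨i, hi⟩ := Function.ne_iff.mp hl0
    have hik : i < k := by by_contra h; exact hi (hlk i (not_lt.mp h))
    rw [Fin.lt_def] at hik
    exact ⟨⟨k - 1, by omega⟩, by simp only; omega⟩
  obtain ⟨g, hg, rfl⟩ := exists_isMirabolic_single_vecMul_eq hr hlk hl0
  have hrk : ∀ i, k ≤ i → (Pi.single r 1 : Fin n → F) i = 0 := fun i hi =>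
    Pi.single_eq_of_ne (by rintro rfl; rw [Fin.le_def] at hi; omega) _
  refine ⟨ψ, Pi.single r 1, hrk, fun h hh => ?_, (Submodule.ne_bot_iff _).mpr ⟨ρ g v,
    ⟨hWρ g hg v hv, map_mem_shearWeightSpace hrk hg (mem_shearWeightSpace.mpr fun a => ?_)⟩, ?_⟩⟩
  · rw [single_one_vecMul, hh.2 r (by omega)]
  · rw [hχ, hl]
  · intro h
    refine hv0 ?_
    rw [← ρ.inv_self_apply g v, h, map_zero]

end ShearWeightSpaces

section UnitriangularEigenvectors

variable {F : Type} [Field F] [Fintype F] {K M : Type*} [Field K] [AddCommGroup M] [Module K M]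
  {n p : ℕ}

/-- Every nonzero subspace stable under a mirabolic subgroup contains a common eigenvector of the
unitriangular matrices in that subgroup. -/
lemma exists_mem_forall_isMirabolic_smul (hp : p ≠ 0) (hpF : (p : F) = 0)
    (hsplit : (Polynomial.X ^ p - 1 : Polynomial K).Splits)
    (ρ : Representation K (GL (Fin n) F) M) {k : ℕ} (hk : k ≤ n) :
    ∀ W : Submodule K M, W ≠ ⊥ → (∀ g, IsMirabolic k g → ∀ w ∈ W, ρ g w ∈ W) →
      ∃ v ∈ W, v ≠ 0 ∧ ∀ u ∈ UT F n, IsMirabolic k u → ∃ c : K, ρ u v = c • v := by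
  induction k with
  | zero =>
    intro W hW _
    obtain ⟨v, hv, hv0⟩ := W.exists_mem_ne_zero_of_ne_bot hW
    refine ⟨v, hv, hv0, fun u _ hu => ⟨1, ?_⟩⟩
    have : u = 1 := by
      ext i j
      have := congrFun (hu.1 j (Nat.zero_le _)) i
      simpa [one_apply, Pi.single_apply] using this
    simp [this]
  | succ k ih =>
    intro W hW hWρ
    obtain ⟨ψ, l, hl, hfix, hne⟩ :=
      exists_inf_shearWeightSpace_ne_bot hp hpF hsplit ρ ⟨k, hk⟩ hW hWρ
    obtain ⟨v, hv, hv0, hev⟩ := ih (Nat.le_of_succ_le hk) _ hne fun g hg w hw =>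
      ⟨hWρ g hg.succ w hw.1, map_mem_shearWeightSpace hl hg.succ ((hfix g hg).symm ▸ hw.2)⟩
    refine ⟨v, hv.1, hv0, fun u hu hu' => ?_⟩
    obtain ⟨a, u', hmem, hmir, rfl⟩ := exists_colShear_mul_eq (k := ⟨k, hk⟩) hu hu'
    obtain ⟨c, hc⟩ := hev u' hmem hmir
    refine ⟨c * ψ (l ⬝ᵥ a), ?_⟩
    rw [map_mul, Module.End.mul_apply, hc, map_smul, mem_shearWeightSpace.mp hv.2, smul_smul]

/-- Every nonzero subrepresentation of a representation of `GL_n(F)` contains a common eigenvector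
of the unitriangular group, if `X ^ p - 1` splits over the coefficient field, `p` being the
characteristic of `F`. -/
lemma exists_mem_forall_UT_smul (hp : p ≠ 0) (hpF : (p : F) = 0)
    (hsplit : (Polynomial.X ^ p - 1 : Polynomial K).Splits)
    (ρ : Representation K (GL (Fin n) F) M) {W : Submodule K M} (hW : W ≠ ⊥)
    (hWρ : ∀ g, ∀ w ∈ W, ρ g w ∈ W) :
    ∃ v ∈ W, v ≠ 0 ∧ ∀ u ∈ UT F n, ∃ c : K, ρ u v = c • v := by
  obtain ⟨v, hv, hv0, hev⟩ := exists_mem_forall_isMirabolic_smul hp hpF hsplit ρ le_rfl W hW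
    fun g _ => hWρ g
  exact ⟨v, hv, hv0, fun u hu => hev u hu (isMirabolic_of_mem_UT hu fun j hj =>
    absurd j.isLt hj.not_gt)⟩

end UnitriangularEigenvectors

section Socle

variable {A M : Type*} [Ring A] [AddCommGroup M] [Module A M]

lemma isSimpleModule_of_forall_le {S : Submodule A M} (hS : S ≠ ⊥)
    (hmin : ∀ N : Submodule A M, N ≠ ⊥ → S ≤ N) : IsSimpleModule A S :=
  isSimpleModule_iff_isAtom.mpr ⟨hS, fun N hN => by
    by_contra h
    exact hN.not_ge (hmin N h)⟩

/-- If a nonzero submodule is contained in every nonzero submodule, it is the socle. -/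
lemma socleMod_eq_of_forall_le {S : Submodule A M} (hS : S ≠ ⊥)
    (hmin : ∀ N : Submodule A M, N ≠ ⊥ → S ≤ N) : socleMod A M = S := by
  refine le_antisymm (sSup_le fun N hN => ?_) (le_sSup (isSimpleModule_of_forall_le hS hmin))
  have hN := isSimpleModule_iff_isAtom.mp hN
  exact ((hN.le_iff.mp (hmin N hN.1)).resolve_left hS).ge

lemma isSimpleModule_iff_isSemisimpleModule_of_forall_le {S : Submodule A M} (hS : S ≠ ⊥)
    (hmin : ∀ N : Submodule A M, N ≠ ⊥ → S ≤ N) :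
    IsSimpleModule A M ↔ IsSemisimpleModule A M := by
  refine ⟨fun _ => inferInstance, fun _ => ?_⟩
  have htop : S = ⊤ := by
    rw [← socleMod_eq_of_forall_le hS hmin]
    exact IsSemisimpleModule.sSup_simples_eq_top A M
  subst htop
  have := isSimpleModule_of_forall_le hS hmin
  exact IsSimpleModule.congr Submodule.topEquiv.symm

end Socle

/-- If a nonzero `KG`-module `M` has a one-dimensional `U`-invariant
subspace `L` contained in the `KG`-submodule generated by every one-dimensional
`U`-invariant subspace, then the socle of `M` is irreducible and equals the
`KG`-submodule generated by `L`; consequently `M` is irreducible iff completely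
reducible. -/
theorem statement_2
    (p m q : ℕ) (hp : p.Prime) (hm : 0 < m) (hq : q = p ^ m)
    (F : Type) [Field F] [Fintype F] [DecidableEq F] (hF : Fintype.card F = q)
    (n : ℕ) (hn : 1 ≤ n)
    (K : Type) [Field K] (hK : ringChar K ≠ p → ∃ ζ : K, IsPrimitiveRoot ζ p)
    (M : Type) [AddCommGroup M] [Module K M]
    [Module (MonoidAlgebra K (GL (Fin n) F)) M]
    [IsScalarTower K (MonoidAlgebra K (GL (Fin n) F)) M]
    (hM : Nontrivial M)
    (L : Submodule K M)
    (hL1 : ∃ v : M, v ≠ 0 ∧ L = Submodule.span K {v})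
    (hLinv : ∀ u : (UT F n), ∀ x ∈ L,
      (MonoidAlgebra.of K (GL (Fin n) F) (u : GL (Fin n) F)) • x ∈ L)
    (hmin : ∀ L' : Submodule K M, (∃ v : M, v ≠ 0 ∧ L' = Submodule.span K {v}) →
      (∀ u : (UT F n), ∀ x ∈ L',
        (MonoidAlgebra.of K (GL (Fin n) F) (u : GL (Fin n) F)) • x ∈ L') →
      (L : Set M) ⊆
        (Submodule.span (MonoidAlgebra K (GL (Fin n) F)) (L' : Set M) : Set M)) :
    IsSimpleModule (MonoidAlgebra K (GL (Fin n) F))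
      ↥(socleMod (MonoidAlgebra K (GL (Fin n) F)) M) ∧
    socleMod (MonoidAlgebra K (GL (Fin n) F)) M
      = Submodule.span (MonoidAlgebra K (GL (Fin n) F)) (L : Set M) ∧
    (IsSimpleModule (MonoidAlgebra K (GL (Fin n) F)) M ↔
      IsSemisimpleModule (MonoidAlgebra K (GL (Fin n) F)) M) := by
  have hpF : (p : F) = 0 := by
    have h : ((p ^ m : ℕ) : F) = 0 := by rw [← hq, ← hF]; exact Nat.cast_card_eq_zero F
    rw [Nat.cast_pow] at h
    exact eq_zero_of_pow_eq_zero h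
  have hρ : ∀ g x, Representation.ofModule' (k := K) (G := GL (Fin n) F) M g x =
      MonoidAlgebra.of K (GL (Fin n) F) g • x := fun _ _ => rfl
  have hle : ∀ N : Submodule (MonoidAlgebra K (GL (Fin n) F)) M, N ≠ ⊥ →
      Submodule.span (MonoidAlgebra K (GL (Fin n) F)) (L : Set M) ≤ N := by
    intro N hN
    obtain ⟨v, hv, hv0, hev⟩ := exists_mem_forall_UT_smul hp.ne_zero hpF
      (splits_X_pow_sub_one_of_ringChar hp hK) (Representation.ofModule' M)
      (W := N.restrictScalars K) (by simpa using hN) (fun g w hw => N.smul_mem _ hw)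
    refine Submodule.span_le.mpr ((hmin (Submodule.span K {v}) ⟨v, hv0, rfl⟩ ?_).trans ?_)
    · intro u x hx
      obtain ⟨a, rfl⟩ := Submodule.mem_span_singleton.mp hx
      obtain ⟨c, hc⟩ := hev u u.2
      rw [← hρ, map_smul, hc]
      exact Submodule.smul_mem _ _ (Submodule.smul_mem _ _ (Submodule.mem_span_singleton_self v))
    · refine Submodule.span_le.mpr fun x hx => ?_
      obtain ⟨a, rfl⟩ := Submodule.mem_span_singleton.mp hx
      exact (N.restrictScalars K).smul_mem a hv
  have hne : Submodule.span (MonoidAlgebra K (GL (Fin n) F)) (L : Set M) ≠ ⊥ := by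
    obtain ⟨v, hv0, rfl⟩ := hL1
    exact (Submodule.ne_bot_iff _).mpr
      ⟨v, Submodule.subset_span (Submodule.mem_span_singleton_self v), hv0⟩
  have hsocle := socleMod_eq_of_forall_le hne hle
  exact ⟨hsocle ▸ isSimpleModule_of_forall_le hne hle, hsocle,
    isSimpleModule_iff_isSemisimpleModule_of_forall_le hne hle⟩
end
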